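/- Let σ ∈ [0,1]. (a) If g ∈ G_σ^×(ℝ^p), then there exist constants c, C > 0 such that c⟨v⟩ ≤ ⟨g(v)⟩ ≤ C⟨v⟩ for all v ∈ ℝ^p. (b) If g ∈ O_M^×(ℝ^p, ℝ^p), then there exist K', K'' > 0 and q ≥ 1 such that K'⟨v⟩^{1/q} ≤ ⟨g(v)⟩ ≤ K''⟨v⟩^{q} for all v ∈ ℝ^p. -/

import Mathlib

open MeasureTheory
open scoped BigOperators

noncomputable section

/-- Japanese bracket `⟨v⟩ = (1 + ‖v‖²)^(1/2)` (with the Euclidean norm). -/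
def jb {n : ℕ} (v : Fin n → ℝ) : ℝ := Real.sqrt (1 + ∑ i, (v i) ^ 2)

/-- Japanese bracket of a pair of vectors, `⟨(x,y)⟩`. -/
def jb2 {n m : ℕ} (x : Fin n → ℝ) (y : Fin m → ℝ) : ℝ :=
  Real.sqrt (1 + ∑ i, (x i) ^ 2 + ∑ j, (y j) ^ 2)

/-- Euclidean inner product `⟨ϑ, ζ⟩`. -/
def ip {n : ℕ} (ϑ ζ : Fin n → ℝ) : ℝ := ∑ i, ϑ i * ζ i

/-- Partial derivative in the `i`-th coordinate direction. -/
def pd {n : ℕ} {E : Type*} [NormedAddCommGroup E] [NormedSpace ℝ E]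
    (i : Fin n) (f : (Fin n → ℝ) → E) : (Fin n → ℝ) → E :=
  fun x => fderiv ℝ f x (Pi.single i 1)

/-- Iterated partial derivative `∂^ν` along the multi-index `ν`. -/
def pdm {n : ℕ} {E : Type*} [NormedAddCommGroup E] [NormedSpace ℝ E]
    (ν : Fin n → ℕ) (f : (Fin n → ℝ) → E) : (Fin n → ℝ) → E :=
  (List.finRange n).foldr (fun i g => (pd i)^[ν i] g) f

/-- Mixed partial derivative `∂_x^α ∂_y^β` of a function of two vector variables. -/
def pdm2 {n m : ℕ} {E : Type*} [NormedAddCommGroup E] [NormedSpace ℝ E]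
    (α : Fin n → ℕ) (β : Fin m → ℕ) (f : (Fin n → ℝ) → (Fin m → ℝ) → E) :
    (Fin n → ℝ) → (Fin m → ℝ) → E :=
  fun x y => pdm α (fun x' => pdm β (f x') y) x

/-- Mixed partial derivative `∂_x^α ∂_y^β ∂_z^γ` of a function of three vector variables. -/
def pdm3 {n m k : ℕ} {E : Type*} [NormedAddCommGroup E] [NormedSpace ℝ E]
    (α : Fin n → ℕ) (β : Fin m → ℕ) (γ : Fin k → ℕ)
    (f : (Fin n → ℝ) → (Fin m → ℝ) → (Fin k → ℝ) → E) :
    (Fin n → ℝ) → (Fin m → ℝ) → (Fin k → ℝ) → E :=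
  fun x y z => pdm α (fun x' => pdm β (fun y' => pdm γ (f x' y') z) y) x

/-- Length `|ν|` of a multi-index. -/
def msize {n : ℕ} (ν : Fin n → ℕ) : ℕ := ∑ i, ν i

/-- The class `G_σ(ℝ^n, E)`: smooth functions whose `ν`-th derivative is
`O(⟨v⟩^{-σ(|ν|-1)})` for every `ν ≠ 0`. -/
def GsigmaCl {n : ℕ} {E : Type*} [NormedAddCommGroup E] [NormedSpace ℝ E]
    (σ : ℝ) (f : (Fin n → ℝ) → E) : Prop :=
  ContDiff ℝ (⊤ : ℕ∞) f ∧ ∀ ν : Fin n → ℕ, ν ≠ 0 → ∃ C > 0, ∀ v,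
    ‖pdm ν f v‖ ≤ C * jb v ^ (-(σ * ((msize ν : ℝ) - 1)))

/-- The class `S_σ(ℝ^n)`: smooth real functions whose `ν`-th derivative is
`O(⟨v⟩^{-σ|ν|})` for every `ν`. -/
def SsigmaCl {n : ℕ} (σ : ℝ) (f : (Fin n → ℝ) → ℝ) : Prop :=
  ContDiff ℝ (⊤ : ℕ∞) f ∧ ∀ ν : Fin n → ℕ, ∃ C > 0, ∀ v,
    |pdm ν f v| ≤ C * jb v ^ (-(σ * (msize ν : ℝ)))

/-- `G_σ^×(ℝ^p)`: diffeomorphisms `g` of `ℝ^p` with `g` and `g⁻¹` in `G_σ`. -/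
def GsigmaX {p : ℕ} (σ : ℝ) (g : (Fin p → ℝ) → (Fin p → ℝ)) : Prop :=
  ∃ h : (Fin p → ℝ) → (Fin p → ℝ),
    Function.LeftInverse h g ∧ Function.RightInverse h g ∧ GsigmaCl σ g ∧ GsigmaCl σ h

/-- The class `O_M(ℝ^n, E)`: smooth functions with polynomially bounded derivatives. -/
def OMCl {n : ℕ} {E : Type*} [NormedAddCommGroup E] [NormedSpace ℝ E]
    (f : (Fin n → ℝ) → E) : Prop :=
  ContDiff ℝ (⊤ : ℕ∞) f ∧ ∀ ν : Fin n → ℕ, ∃ C > 0, ∃ k : ℕ, ∀ v,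
    ‖pdm ν f v‖ ≤ C * jb v ^ (k : ℝ)

/-- `O_M^×(ℝ^p, ℝ^p)`: diffeomorphisms `g` of `ℝ^p` with `g` and `g⁻¹` in `O_M`. -/
def OMX {p : ℕ} (g : (Fin p → ℝ) → (Fin p → ℝ)) : Prop :=
  ∃ h : (Fin p → ℝ) → (Fin p → ℝ),
    Function.LeftInverse h g ∧ Function.RightInverse h g ∧ OMCl g ∧ OMCl h

/-- The symbol space `S_σ^{l,m}(ℝ^{2n}, E)`. -/
def Ssym {n : ℕ} {E : Type*} [NormedAddCommGroup E] [NormedSpace ℝ E]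
    (σ l m : ℝ) (a : (Fin n → ℝ) → (Fin n → ℝ) → E) : Prop :=
  ContDiff ℝ (⊤ : ℕ∞) (fun q : (Fin n → ℝ) × (Fin n → ℝ) => a q.1 q.2) ∧
  ∀ α β : Fin n → ℕ, ∃ C > 0, ∀ x ϑ,
    ‖pdm2 α β a x ϑ‖ ≤ C * jb x ^ (σ * (l - (msize α : ℝ))) * jb ϑ ^ (m - (msize β : ℝ))

/-- The amplitude space `Π_{σ,κ}^{l,w,m}(ℝ^{3n}, E)`. -/
def Amp {n : ℕ} {E : Type*} [NormedAddCommGroup E] [NormedSpace ℝ E]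
    (σ κ l w m : ℝ) (a : (Fin n → ℝ) → (Fin n → ℝ) → (Fin n → ℝ) → E) : Prop :=
  ContDiff ℝ (⊤ : ℕ∞)
    (fun q : ((Fin n → ℝ) × (Fin n → ℝ)) × (Fin n → ℝ) => a q.1.1 q.1.2 q.2) ∧
  ∀ α β γ : Fin n → ℕ, ∃ C > 0, ∀ x ζ ϑ,
    ‖pdm3 α β γ a x ζ ϑ‖ ≤
      C * jb x ^ (σ * (l - ((msize α + msize β : ℕ) : ℝ))) *
        jb ζ ^ (w + κ * ((msize α + msize β : ℕ) : ℝ)) * jb ϑ ^ (m - (msize γ : ℝ))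

/-- The space `H_{σ,κ}^{w}(E)` of smooth functions on `ℝ^{2n}`. -/
def Hsp {n : ℕ} {F : Type*} [NormedAddCommGroup F] [NormedSpace ℝ F]
    (σ κ w : ℝ) (g : (Fin n → ℝ) → (Fin n → ℝ) → F) : Prop :=
  ContDiff ℝ (⊤ : ℕ∞) (fun q : (Fin n → ℝ) × (Fin n → ℝ) => g q.1 q.2) ∧
  ∀ α β : Fin n → ℕ, ¬(α = 0 ∧ β = 0) → ∃ C > 0, ∀ x ζ,
    ‖pdm2 α β g x ζ‖ ≤ C * jb x ^ (-(σ * (((msize α + msize β : ℕ) : ℝ) - 1))) *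
      jb ζ ^ (w + κ * (((msize α + msize β : ℕ) : ℝ) - 1))

/-- The space `E_{σ,κ}^{w}(E)` of smooth functions on `ℝ^{2n}`. -/
def Esp {n : ℕ} {F : Type*} [NormedAddCommGroup F] [NormedSpace ℝ F]
    (σ κ w : ℝ) (g : (Fin n → ℝ) → (Fin n → ℝ) → F) : Prop :=
  ContDiff ℝ (⊤ : ℕ∞) (fun q : (Fin n → ℝ) × (Fin n → ℝ) => g q.1 q.2) ∧
  ∀ α β : Fin n → ℕ, ∃ C > 0, ∀ x ζ,
    ‖pdm2 α β g x ζ‖ ≤ C * jb x ^ (-(σ * ((msize α + msize β : ℕ) : ℝ))) *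
      jb ζ ^ (w + κ * ((msize α + msize β : ℕ) : ℝ))

/-- Jacobian determinant of a map `ℝ^p → ℝ^p`. -/
def Jdet {p : ℕ} (g : (Fin p → ℝ) → (Fin p → ℝ)) : (Fin p → ℝ) → ℝ :=
  fun v => LinearMap.det (fderiv ℝ g v).toLinearMap

/-- The seminorm `q_{p,(α,β)}(K) = sup ⟨(x,y)⟩^p |∂^{(α,β)} K (x,y)|`. -/
def qSem {n : ℕ} (p : ℕ) (α β : Fin n → ℕ)
    (K : (Fin n → ℝ) → (Fin n → ℝ) → ℂ) : ℝ :=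
  ⨆ q : (Fin n → ℝ) × (Fin n → ℝ), jb2 q.1 q.2 ^ p * ‖pdm2 α β K q.1 q.2‖

/-- Mixed partial derivative `∂_r^α ∂_θ^β` of a function of two real variables. -/
def pd2 (α β : ℕ) (F : ℝ → ℝ → ℝ) (r θ : ℝ) : ℝ :=
  iteratedDeriv α (fun r' => iteratedDeriv β (fun θ' => F r' θ') θ) r

/-- Smooth real function on `ℝ` with all derivatives bounded. -/
def BddSmooth (a : ℝ → ℝ) : Prop :=
  ContDiff ℝ (⊤ : ℕ∞) a ∧ ∀ k : ℕ, ∃ C : ℝ, ∀ t, |iteratedDeriv k a t| ≤ C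

/-- Inverse hyperbolic cosine, `arcosh x = log (x + √(x²-1))`. -/
def arcosh (x : ℝ) : ℝ := Real.log (x + Real.sqrt (x ^ 2 - 1))

theorem aux_one_le_jb {n : ℕ} (v : Fin n → ℝ) : 1 ≤ jb v := by
  unfold jb
  rw [Real.one_le_sqrt]
  have : 0 ≤ ∑ i, (v i) ^ 2 := Finset.sum_nonneg fun i _ => sq_nonneg _
  linarith

theorem aux_norm_le_jb {n : ℕ} (v : Fin n → ℝ) : ‖v‖ ≤ jb v := by
  rw [pi_norm_le_iff_of_nonneg (zero_le_one.trans (aux_one_le_jb v))]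
  intro i
  unfold jb
  apply Real.le_sqrt_of_sq_le
  rw [Real.norm_eq_abs, sq_abs]
  have := Finset.single_le_sum (f := fun i => (v i) ^ 2) (fun i _ => sq_nonneg _)
    (Finset.mem_univ i)
  linarith

theorem aux_jb_le {n : ℕ} (v : Fin n → ℝ) : jb v ≤ (1 + n) * (1 + ‖v‖) := by
  unfold jb
  have hv := norm_nonneg v
  have hn : (0 : ℝ) ≤ n := Nat.cast_nonneg n
  apply Real.sqrt_le_iff.2
  refine ⟨by positivity, ?_⟩
  have h : ∑ i, (v i) ^ 2 ≤ ∑ _i : Fin n, ‖v‖ ^ 2 := by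
    apply Finset.sum_le_sum
    intro i _
    rw [← sq_abs]
    exact pow_le_pow_left₀ (abs_nonneg _) (norm_le_pi_norm v i) 2
  simp only [Finset.sum_const, Finset.card_univ, Fintype.card_fin, nsmul_eq_mul] at h
  have h1 : (0 : ℝ) ≤ n * ‖v‖ := by positivity
  have h2 : (0 : ℝ) ≤ n * ‖v‖ ^ 2 := by positivity
  have h3 : (0 : ℝ) ≤ (n * ‖v‖) ^ 2 := by positivity
  have h4 : (0 : ℝ) ≤ n ^ 2 * ‖v‖ := by positivity
  nlinarith [sq_nonneg (n : ℝ), sq_nonneg ‖v‖]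

theorem aux_foldr_notMem {n : ℕ} {E : Type*} [NormedAddCommGroup E] [NormedSpace ℝ E]
    (i : Fin n) (f : (Fin n → ℝ) → E) (l : List (Fin n)) (hl : i ∉ l) :
    l.foldr (fun j g => (pd j)^[(Pi.single i 1 : Fin n → ℕ) j] g) f = f := by
  induction l with
  | nil => rfl
  | cons a t ih =>
    simp only [List.mem_cons, not_or] at hl
    rw [List.foldr_cons, ih hl.2, Pi.single_eq_of_ne (Ne.symm hl.1)]
    rfl

theorem aux_foldr_mem {n : ℕ} {E : Type*} [NormedAddCommGroup E] [NormedSpace ℝ E]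
    (i : Fin n) (f : (Fin n → ℝ) → E) (l : List (Fin n)) (hl : i ∈ l) (hd : l.Nodup) :
    l.foldr (fun j g => (pd j)^[(Pi.single i 1 : Fin n → ℕ) j] g) f = pd i f := by
  induction l with
  | nil => simp at hl
  | cons a t ih =>
    rw [List.nodup_cons] at hd
    rw [List.foldr_cons]
    by_cases h : i = a
    · subst h
      rw [aux_foldr_notMem i f t hd.1, Pi.single_eq_same]
      rfl
    · have ht : i ∈ t := by simpa [h] using hl
      rw [ih ht hd.2, Pi.single_eq_of_ne (Ne.symm h)]
      rfl

theorem aux_pdm_single {n : ℕ} {E : Type*} [NormedAddCommGroup E] [NormedSpace ℝ E]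
    (i : Fin n) (f : (Fin n → ℝ) → E) : pdm (Pi.single i 1) f = pd i f :=
  aux_foldr_mem i f _ (List.mem_finRange i) (List.nodup_finRange n)

theorem aux_pdm_zero {n : ℕ} {E : Type*} [NormedAddCommGroup E] [NormedSpace ℝ E]
    (f : (Fin n → ℝ) → E) : pdm 0 f = f := by
  unfold pdm
  induction List.finRange n with
  | nil => rfl
  | cons a t ih =>
    rw [List.foldr_cons, ih]
    rfl

theorem aux_G_upper {p : ℕ} (σ : ℝ) (f : (Fin p → ℝ) → (Fin p → ℝ)) (hf : GsigmaCl σ f) :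
    ∃ C > 0, ∀ v, jb (f v) ≤ C * jb v := by
  obtain ⟨hs, hb⟩ := hf
  have h1 : ∀ i : Fin p, ∃ C > 0, ∀ v, ‖pd i f v‖ ≤ C := by
    intro i
    obtain ⟨C, hC, h⟩ := hb (Pi.single i 1) (by simp)
    refine ⟨C, hC, fun v => ?_⟩
    have := h v
    rw [aux_pdm_single] at this
    simpa [msize] using this
  choose C hC hCb using h1
  have hM : 0 ≤ ∑ i, C i := Finset.sum_nonneg fun i _ => (hC i).le
  have hd : Differentiable ℝ f := hs.differentiable (by simp)
  have hfd : ∀ v, ‖fderiv ℝ f v‖ ≤ ∑ i, C i := by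
    intro v
    refine ContinuousLinearMap.opNorm_le_bound _ hM fun w => ?_
    have hw : w = ∑ i, w i • (Pi.single i 1 : Fin p → ℝ) := by
      ext j
      simp [Finset.sum_apply, Pi.single_apply]
    conv_lhs => rw [hw, map_sum]
    refine (norm_sum_le _ _).trans ?_
    rw [Finset.sum_mul]
    refine Finset.sum_le_sum fun i _ => ?_
    rw [map_smul, norm_smul, mul_comm]
    exact mul_le_mul (hCb i v) (norm_le_pi_norm w i) (norm_nonneg _) (hC i).le
  have hmv : ∀ v, ‖f v‖ ≤ ‖f 0‖ + (∑ i, C i) * ‖v‖ := by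
    intro v
    have := Convex.norm_image_sub_le_of_norm_fderiv_le (𝕜 := ℝ) (f := f) (s := Set.univ)
      (fun x _ => hd x) (fun x _ => hfd x) convex_univ (Set.mem_univ 0) (Set.mem_univ v)
    rw [sub_zero] at this
    have h2 := norm_le_norm_add_norm_sub' (f v) (f 0)
    linarith
  refine ⟨(1 + p) * (1 + ‖f 0‖ + ∑ i, C i), by positivity, fun v => ?_⟩
  refine (aux_jb_le _).trans ?_
  rw [mul_assoc]
  refine mul_le_mul_of_nonneg_left ?_ (by positivity)
  have h3 := aux_one_le_jb v
  have h4 := mul_le_mul_of_nonneg_left (aux_norm_le_jb v) hM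
  have h5 := hmv v
  nlinarith [norm_nonneg (f 0)]

theorem aux_OM_upper {p : ℕ} (f : (Fin p → ℝ) → (Fin p → ℝ)) (hf : OMCl f) :
    ∃ C > 0, ∃ k : ℕ, ∀ v, jb (f v) ≤ C * jb v ^ (k : ℝ) := by
  obtain ⟨C, hC, k, h⟩ := hf.2 0
  rw [aux_pdm_zero] at h
  refine ⟨(1 + p) * (1 + C), by positivity, k, fun v => ?_⟩
  refine (aux_jb_le _).trans ?_
  rw [mul_assoc]
  refine mul_le_mul_of_nonneg_left ?_ (by positivity)
  have h3 : 1 ≤ jb v ^ (k : ℝ) := Real.one_le_rpow (aux_one_le_jb v) (Nat.cast_nonneg k)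
  have := h v
  linarith

/-- Bracket growth estimates: a `G_σ^×` diffeomorphism satisfies
`c⟨v⟩ ≤ ⟨g v⟩ ≤ C⟨v⟩`, and an `O_M^×` diffeomorphism satisfies
`K'⟨v⟩^{1/q} ≤ ⟨g v⟩ ≤ K''⟨v⟩^{q}` for some `q ≥ 1`. -/
theorem statement2 {p : ℕ} (σ : ℝ) (hσ : σ ∈ Set.Icc (0 : ℝ) 1)
    (g : (Fin p → ℝ) → (Fin p → ℝ)) :
    (GsigmaX σ g → ∃ c > 0, ∃ C > 0, ∀ v,
      c * jb v ≤ jb (g v) ∧ jb (g v) ≤ C * jb v) ∧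
    (OMX g → ∃ K' > 0, ∃ K'' > 0, ∃ q : ℝ, 1 ≤ q ∧ ∀ v,
      K' * jb v ^ (1 / q) ≤ jb (g v) ∧ jb (g v) ≤ K'' * jb v ^ q) := by
  constructor
  · rintro ⟨h, hl, -, hg, hh⟩
    obtain ⟨C, hC, hCb⟩ := aux_G_upper σ g hg
    obtain ⟨D, hD, hDb⟩ := aux_G_upper σ h hh
    refine ⟨D⁻¹, by positivity, C, hC, fun v => ⟨?_, hCb v⟩⟩
    have := hDb (g v)
    rw [hl v] at this
    rwa [inv_mul_le_iff₀ hD]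
  · rintro ⟨h, hl, -, hg, hh⟩
    obtain ⟨C, hC, k, hCb⟩ := aux_OM_upper g hg
    obtain ⟨D, hD, m, hDb⟩ := aux_OM_upper h hh
    have hq : (0 : ℝ) < k + m + 1 := by positivity
    refine ⟨(D ^ (1 / ((k : ℝ) + m + 1)))⁻¹, by positivity, C, hC, k + m + 1, ?_,
      fun v => ⟨?_, ?_⟩⟩
    · have : (0 : ℝ) ≤ k + m := by positivity
      linarith
    · have h0 : 0 ≤ jb v := zero_le_one.trans (aux_one_le_jb v)
      have h1 : 0 ≤ jb (g v) := zero_le_one.trans (aux_one_le_jb _)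
      rw [inv_mul_le_iff₀ (by positivity)]
      have h2 : jb v ≤ D * jb (g v) ^ ((k : ℝ) + m + 1) := by
        have := hDb (g v)
        rw [hl v] at this
        refine this.trans (mul_le_mul_of_nonneg_left ?_ hD.le)
        refine Real.rpow_le_rpow_of_exponent_le (aux_one_le_jb _) ?_
        have : (0 : ℝ) ≤ k := by positivity
        linarith
      have h3 := Real.rpow_le_rpow h0 h2 (by positivity : 0 ≤ 1 / ((k : ℝ) + m + 1))
      rwa [Real.mul_rpow hD.le (by positivity), ← Real.rpow_mul h1,
        mul_one_div_cancel hq.ne', Real.rpow_one] at h3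
    · refine (hCb v).trans (mul_le_mul_of_nonneg_left ?_ hC.le)
      refine Real.rpow_le_rpow_of_exponent_le (aux_one_le_jb _) ?_
      have : (0 : ℝ) ≤ m := by positivity
      linarith
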